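/- Fix integers d ≥ 4 and 2 ≤ k ≤ d−2. Let C = C_1 ⊕ C_2, where C_1 = ⨁_{i=0}^{d−k−1} PV^{k+1+i}⟨−i⟩ carries the differential sending μ ∈ PV^{k+1+i}⟨−i⟩ to ∂μ ∈ PV^{k+i}⟨−(i−1)⟩ for i ≥ 1 and zero on the i = 0 summand, and C_2 = ⨁_{(i,j): i,j ≥ 0, i+j ≤ d−1, i+j ≠ k} PV^j⟨i⟩ carries the differential sending μ ∈ PV^j⟨i⟩ to ∂μ ∈ PV^{j−1}⟨i+1⟩ (zero when j = 0); these differentials assemble to a square-zero map T on C. Then ker T / im T is ℂ-linearly isomorphic to ℂ ⊕ PV^{k+1}/∂(PV^{k+2}) ⊕ ⨁_{j ≤ d−1, j ≠ k} PV^j_∂, where the ℂ-summand is realized by the classes of constant multiples of ξ_1⋯ξ_d in the summand PV^d⟨−(d−k−1)⟩ of C_1, the middle summand is realized in the summand PV^{k+1}⟨0⟩ of C_1 (whose intersection with im T is exactly ∂(PV^{k+2})), and the last summand is realized by the ⟨0⟩-inclusions of divergence-free elements into C_2. (This computes the cohomology of the fields of minimal BCOV theory with k-potentials on ℂ^d with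 respect to t∂.) -/

import Mathlib

/-!
Setup: the supercommutative algebra `A = ℂ[x_1,…,x_d] ⊗ Λ[ξ_1,…,ξ_d]`
of polynomial polyvector fields on `ℂ^d`, encoded by coefficients: an element
`f : PVA d` assigns to each finite set `S ⊆ Fin d` the polynomial coefficient
of the monomial `ξ_S` (the product of the `ξ_i`, `i ∈ S`, in increasing order).
-/

noncomputable section

namespace BCOV

/-- Polynomial coefficient ring `ℂ[x_1,…,x_d]`. -/
abbrev MPoly (d : ℕ) : Type := MvPolynomial (Fin d) ℂ

/-- The algebra `A` of polynomial polyvector fields on `ℂ^d`. -/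
abbrev PVA (d : ℕ) : Type := Finset (Fin d) → MPoly d

variable {d : ℕ}

/-- Koszul sign arising when multiplying `ξ_T · ξ_U` for disjoint `T`, `U`. -/
def koszulSign (T U : Finset (Fin d)) : ℂ :=
  (-1 : ℂ) ^ (((T ×ˢ U).filter fun p : (Fin d) × (Fin d) => p.2 < p.1).card)

/-- The supercommutative product on `A`. -/
def mul (f g : PVA d) : PVA d := fun S =>
  ∑ T ∈ S.powerset, koszulSign T (S \ T) • (f T * g (S \ T))

/-- The even partial derivative `∂/∂x_i`. -/
def Dx (i : Fin d) (f : PVA d) : PVA d := fun S => MvPolynomial.pderiv i (f S)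

/-- The left odd partial derivative `∂/∂ξ_i`. -/
def Dxi (i : Fin d) (f : PVA d) : PVA d := fun S =>
  if i ∈ S then 0
  else ((-1 : ℂ) ^ ((S.filter fun j => j < i).card)) • f (insert i S)

/-- The divergence operator `∂ = Σ_i ∂_{x_i} ∂_{ξ_i}` (with respect to the
standard holomorphic volume form). -/
def dvg (f : PVA d) : PVA d := ∑ i : Fin d, Dx i (Dxi i f)

/-- `f` lies in `PV^j`: only coefficients of `ξ`-monomials of length `j` occur. -/
def IsHomog (j : ℕ) (f : PVA d) : Prop :=
  ∀ S : Finset (Fin d), S.card ≠ j → f S = 0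

/-- The Schouten–Nijenhuis bracket `[f, g]` of `f ∈ PV^a` with `g`:
`[f,g] = (−1)^{a−1} (∂(fg) − (∂f)g − (−1)^a f (∂g))`. -/
def sn (a : ℕ) (f g : PVA d) : PVA d :=
  ((-1 : ℂ) ^ (a + 1)) •
    (dvg (mul f g) - mul (dvg f) g - ((-1 : ℂ) ^ a) • mul f (dvg g))

/-- The top polyvector field `ξ_1 ⋯ ξ_d`. -/
def xiTop : PVA d := fun S => if S = Finset.univ then 1 else 0

/-- `τ`: the value at `x = 0` of the coefficient of `ξ_1 ⋯ ξ_d`. -/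
def tauA (f : PVA d) : ℂ := MvPolynomial.constantCoeff (f Finset.univ)

/-- `σ`: the constant term. -/
def sigmaA (f : PVA d) : ℂ := MvPolynomial.constantCoeff (f ∅)

lemma Dx_add (i : Fin d) (f g : PVA d) : Dx i (f + g) = Dx i f + Dx i g := by
  funext S; simp [Dx]

lemma Dx_smul (i : Fin d) (c : ℂ) (f : PVA d) : Dx i (c • f) = c • Dx i f := by
  funext S; simp [Dx]

lemma Dxi_add (i : Fin d) (f g : PVA d) : Dxi i (f + g) = Dxi i f + Dxi i g := by
  funext S
  by_cases h : i ∈ S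
  · simp [Dxi, h]
  · simp [Dxi, h, smul_add]

lemma Dxi_smul (i : Fin d) (c : ℂ) (f : PVA d) : Dxi i (c • f) = c • Dxi i f := by
  funext S
  by_cases h : i ∈ S
  · simp [Dxi, h]
  · simp only [Dxi, if_neg h, Pi.smul_apply]
    rw [smul_comm]

lemma dvg_add (f g : PVA d) : dvg (f + g) = dvg f + dvg g := by
  simp [dvg, Dxi_add, Dx_add, Finset.sum_add_distrib]

lemma dvg_smul (c : ℂ) (f : PVA d) : dvg (c • f) = c • dvg f := by
  simp [dvg, Dxi_smul, Dx_smul, Finset.smul_sum]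

/-- The divergence operator as a `ℂ`-linear endomorphism of `A`. -/
def dvgL (d : ℕ) : PVA d →ₗ[ℂ] PVA d where
  toFun := dvg
  map_add' := dvg_add
  map_smul' := dvg_smul

lemma IsHomog.add {j : ℕ} {f g : PVA d} (hf : IsHomog j f) (hg : IsHomog j g) :
    IsHomog j (f + g) := fun S hS => by
  simp only [Pi.add_apply, hf S hS, hg S hS, add_zero]

lemma isHomog_zero {j : ℕ} : IsHomog j (0 : PVA d) := fun _ _ => rfl

lemma IsHomog.smul {j : ℕ} {f : PVA d} (c : ℂ) (hf : IsHomog j f) :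
    IsHomog j (c • f) := fun S hS => by
  simp only [Pi.smul_apply, hf S hS, smul_zero]

/-- The subspace `PV^j ⊆ A` of `j`-polyvector fields. -/
def PVsub (d j : ℕ) : Submodule ℂ (PVA d) where
  carrier := {f | IsHomog j f}
  add_mem' hf hg := hf.add hg
  zero_mem' := isHomog_zero
  smul_mem' c _ hf := hf.smul c

/-- The subspace `PV^j_∂ ⊆ A` of divergence-free `j`-polyvector fields. -/
def PVd (d j : ℕ) : Submodule ℂ (PVA d) := PVsub d j ⊓ LinearMap.ker (dvgL d)

variable (d k : ℕ)

/-- Ambient space containing `C = C_1 ⊕ C_2`: the first factor encodes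
`C_1 = ⨁_{i=0}^{d−k−1} PV^{k+1+i}⟨−i⟩` (the function `i ↦` component in the
copy `PV^{k+1+i}⟨−i⟩`), the second factor encodes
`C_2 = ⨁_{(i,j) : i+j ≤ d−1, i+j ≠ k} PV^j⟨i⟩` (the function `(j,i) ↦`
component in the copy `PV^j⟨i⟩`). -/
abbrev F11 (d : ℕ) := (ℕ → PVA d) × ((ℕ × ℕ) → PVA d)

/-- The `ℂ`-linear differential `T`: on `C_1` it sends `μ ∈ PV^{k+1+i}⟨−i⟩` to
`∂μ ∈ PV^{k+i}⟨−(i−1)⟩` for `i ≥ 1` and is zero on the `i = 0` summand; on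
`C_2` it sends `μ ∈ PV^j⟨i⟩` to `∂μ ∈ PV^{j−1}⟨i+1⟩` (zero when `j = 0`). -/
def T11 (d : ℕ) : F11 d →ₗ[ℂ] F11 d where
  toFun c := (fun i => dvg (c.1 (i + 1)),
    fun p => if p.2 = 0 then 0 else dvg (c.2 (p.1 + 1, p.2 - 1)))
  map_add' m n := by
    refine Prod.ext ?_ ?_
    · funext i; simp [dvg_add]
    · funext p; by_cases h : p.2 = 0 <;> simp [h, dvg_add]
  map_smul' c m := by
    refine Prod.ext ?_ ?_
    · funext i; simp [dvg_smul]
    · funext p; by_cases h : p.2 = 0 <;> simp [h, dvg_smul]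

/-- The subspace `C = C_1 ⊕ C_2`, where
`C_1 = ⨁_{i=0}^{d−k−1} PV^{k+1+i}⟨−i⟩` and
`C_2 = ⨁_{(i,j) : i,j ≥ 0, i+j ≤ d−1, i+j ≠ k} PV^j⟨i⟩`. -/
def C11 (d k : ℕ) : Submodule ℂ (F11 d) where
  carrier := {c |
    (∀ i : ℕ, IsHomog (k + 1 + i) (c.1 i) ∧ (d - k - 1 < i → c.1 i = 0)) ∧
    (∀ p : ℕ × ℕ, IsHomog p.1 (c.2 p) ∧
      (d - 1 < p.1 + p.2 ∨ p.1 + p.2 = k → c.2 p = 0))}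
  add_mem' := fun {f g} hf hg =>
    ⟨fun i => ⟨((hf.1 i).1).add (hg.1 i).1,
      fun h => by simp only [Prod.fst_add, Pi.add_apply, (hf.1 i).2 h, (hg.1 i).2 h, add_zero]⟩,
     fun p => ⟨((hf.2 p).1).add (hg.2 p).1,
      fun h => by simp only [Prod.snd_add, Pi.add_apply, (hf.2 p).2 h, (hg.2 p).2 h, add_zero]⟩⟩
  zero_mem' := ⟨fun i => ⟨isHomog_zero, fun _ => rfl⟩,
    fun p => ⟨isHomog_zero, fun _ => rfl⟩⟩
  smul_mem' := fun c f hf =>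
    ⟨fun i => ⟨((hf.1 i).1).smul c,
      fun h => by simp only [Prod.smul_fst, Pi.smul_apply, (hf.1 i).2 h, smul_zero]⟩,
     fun p => ⟨((hf.2 p).1).smul c,
      fun h => by simp only [Prod.smul_snd, Pi.smul_apply, (hf.2 p).2 h, smul_zero]⟩⟩

/-- The subspace `∂(PV^{k+2}) ⊆ PV^{k+1}`. -/
def Dq (d k : ℕ) : Submodule ℂ ↥(PVsub d (k + 1)) :=
  Submodule.comap (PVsub d (k + 1)).subtype
    (Submodule.map (dvgL d) (PVsub d (k + 2)))

/-- `W = ℂ ⊕ PV^{k+1}/∂(PV^{k+2}) ⊕ ⨁_{j ≤ d−1, j ≠ k} PV^j_∂`. -/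
abbrev W11 (d k : ℕ) :=
  ℂ × (↥(PVsub d (k + 1)) ⧸ Dq d k) ×
    (∀ j : {j : Fin d // (j : ℕ) ≠ k}, ↥(PVd d ((j : Fin d) : ℕ)))

/-- Realization of the `ℂ`-summand: constant multiples of `ξ_1⋯ξ_d` in the
summand `PV^d⟨−(d−k−1)⟩` of `C_1`. -/
def e1 (d k : ℕ) (z : ℂ) : F11 d :=
  (fun i => if i = d - k - 1 then z • xiTop else 0, 0)

/-- Realization of `PV^{k+1}`: the summand `PV^{k+1}⟨0⟩` of `C_1`. -/
def e2 (d : ℕ) (μ : PVA d) : F11 d := (fun i => if i = 0 then μ else 0, 0)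

/-- Realization of `⨁_{j ≤ d−1, j ≠ k} PV^j_∂`: the `⟨0⟩`-inclusions of
divergence-free elements into `C_2`. -/
def e3 (d k : ℕ)
    (n : ∀ j : {j : Fin d // (j : ℕ) ≠ k}, ↥(PVd d ((j : Fin d) : ℕ))) :
    F11 d :=
  (0, fun p => if h : p.2 = 0 ∧ p.1 < d ∧ p.1 ≠ k
    then (n ⟨⟨p.1, h.2.1⟩, h.2.2⟩ : PVA d) else 0)

/-- The cohomology `ker T / im T` of `(C, T)`. -/
abbrev Coh11 (d k : ℕ) :=
  ↥(C11 d k ⊓ LinearMap.ker (T11 d)) ⧸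
    (Submodule.comap (C11 d k ⊓ LinearMap.ker (T11 d)).subtype
      (Submodule.map (T11 d) (C11 d k)))

/-- The sign of moving `ξ_i` past the `ξ_j` with `j ∈ S`, `j < i`. -/
def moveSign {d : ℕ} (i : Fin d) (S : Finset (Fin d)) : ℂ :=
  (-1 : ℂ) ^ ((S.filter fun j => j < i).card)

/-- Left multiplication by `ξ_i`. -/
def mulXi {d : ℕ} (i : Fin d) (f : PVA d) : PVA d := fun S =>
  if i ∈ S then moveSign i S • f (S.erase i) else 0

/-- Multiplication by `x_i`. -/
def mulX {d : ℕ} (i : Fin d) (f : PVA d) : PVA d := fun S => MvPolynomial.X i * f S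

/-- The operator `Σ_i x_i ξ_i`, a contracting homotopy for the divergence. -/
def homotopy {d : ℕ} (f : PVA d) : PVA d := ∑ i : Fin d, mulX i (mulXi i f)

section Operators

variable {d : ℕ}

lemma moveSign_mul_self (i : Fin d) (S : Finset (Fin d)) :
    moveSign i S * moveSign i S = 1 := by
  rw [moveSign, ← mul_pow]; simp

lemma moveSign_insert_self (i : Fin d) (S : Finset (Fin d)) :
    moveSign i (insert i S) = moveSign i S := by
  rw [moveSign, moveSign, Finset.filter_insert]; simp

lemma moveSign_insert {i j : Fin d} {S : Finset (Fin d)} (hj : j ∉ S) :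
    moveSign i (insert j S) = (if j < i then -1 else 1) * moveSign i S := by
  rw [moveSign, moveSign, Finset.filter_insert]
  split_ifs with h
  · rw [Finset.card_insert_of_notMem (by simp [hj]), pow_succ]; ring
  · simp

lemma Dxi_apply (i : Fin d) (f : PVA d) (S : Finset (Fin d)) :
    Dxi i f S = if i ∈ S then 0 else moveSign i S • f (insert i S) := rfl

lemma Dxi_Dxi (i j : Fin d) (f : PVA d) : Dxi i (Dxi j f) = -Dxi j (Dxi i f) := by
  funext S
  simp only [Dxi_apply, Pi.neg_apply, Finset.mem_insert]
  by_cases hij : i = j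
  · subst hij; simp
  by_cases hi : i ∈ S
  · simp [hi]
  by_cases hj : j ∈ S
  · simp [hj]
  have hji : ¬ j = i := fun h => hij h.symm
  simp only [hi, hj, hij, hji, if_false, or_self, moveSign_insert hi, moveSign_insert hj,
    smul_smul, Finset.insert_comm j i, ← neg_smul]
  congr 1
  rcases lt_or_gt_of_ne hij with h | h
  · simp only [h, h.asymm, if_true, if_false]; ring
  · simp only [h, h.asymm, if_true, if_false]; ring

lemma Dxi_mulXi_of_ne {i j : Fin d} (hij : i ≠ j) (f : PVA d) :
    Dxi i (mulXi j f) = -mulXi j (Dxi i f) := by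
  funext S
  simp only [Dxi_apply, mulXi, Pi.neg_apply, Finset.mem_insert, Finset.mem_erase]
  by_cases hi : i ∈ S
  · simp [hi, hij]
  by_cases hj : j ∈ S
  · obtain ⟨S, hjS, rfl⟩ : ∃ S', j ∉ S' ∧ S = insert j S' :=
      ⟨S.erase j, by simp, (Finset.insert_erase hj).symm⟩
    have hi' : i ∉ S := fun h => hi (Finset.mem_insert_of_mem h)
    have hj' : j ∉ insert i S := by simp [hjS, hij.symm]
    rw [Finset.insert_comm i j, Finset.erase_insert hj', Finset.erase_insert hjS,
      moveSign_insert_self, moveSign_insert_self, moveSign_insert hi', moveSign_insert hjS]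
    simp only [hi', hij, hij.symm, Finset.mem_insert, hjS, true_or, or_true, or_self, if_true,
      if_false, smul_smul, ← neg_smul, and_false]
    congr 1
    rcases lt_or_gt_of_ne hij with h | h
    · simp only [h, h.asymm, if_true, if_false]; ring
    · simp only [h, h.asymm, if_true, if_false]; ring
  · simp [hj, hij.symm]

lemma Dxi_mulXi_self (i : Fin d) (f : PVA d) (S : Finset (Fin d)) :
    Dxi i (mulXi i f) S = if i ∈ S then 0 else f S := by
  by_cases hi : i ∈ S
  · simp [Dxi_apply, hi]
  · simp [Dxi_apply, mulXi, hi, moveSign_insert_self, smul_smul, moveSign_mul_self]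

lemma mulXi_Dxi_self (i : Fin d) (f : PVA d) (S : Finset (Fin d)) :
    mulXi i (Dxi i f) S = if i ∈ S then f S else 0 := by
  by_cases hi : i ∈ S
  · obtain ⟨S, hS, rfl⟩ : ∃ S', i ∉ S' ∧ S = insert i S' :=
      ⟨S.erase i, by simp, (Finset.insert_erase hi).symm⟩
    simp [Dxi_apply, mulXi, hS, moveSign_insert_self, smul_smul, moveSign_mul_self]
  · simp [mulXi, hi]

lemma Dxi_Dx (i j : Fin d) (f : PVA d) : Dxi i (Dx j f) = Dx j (Dxi i f) := by
  funext S
  by_cases h : i ∈ S <;> simp [Dxi_apply, Dx, h]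

lemma Dx_Dx (i j : Fin d) (f : PVA d) : Dx i (Dx j f) = Dx j (Dx i f) := by
  funext S
  have h : ⁅MvPolynomial.pderiv (R := ℂ) i, MvPolynomial.pderiv (R := ℂ) j⁆ = 0 := by
    apply MvPolynomial.derivation_ext
    intro l
    simp [Derivation.commutator_apply, MvPolynomial.pderiv_X, Pi.single_apply,
      apply_ite (MvPolynomial.pderiv (R := ℂ) (σ := Fin d) _)]
  have := DFunLike.congr_fun h (f S)
  rw [Derivation.commutator_apply] at this
  exact sub_eq_zero.mp this

lemma Dxi_sum (i : Fin d) {ι : Type*} (s : Finset ι) (f : ι → PVA d) :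
    Dxi i (∑ a ∈ s, f a) = ∑ a ∈ s, Dxi i (f a) := by
  funext S
  by_cases h : i ∈ S <;> simp [Dxi_apply, h, Finset.smul_sum]

lemma Dx_sum (i : Fin d) {ι : Type*} (s : Finset ι) (f : ι → PVA d) :
    Dx i (∑ a ∈ s, f a) = ∑ a ∈ s, Dx i (f a) := by
  funext S
  simp [Dx]

lemma Dx_neg (i : Fin d) (f : PVA d) : Dx i (-f) = -Dx i f := by
  funext S
  simp [Dx]

lemma dvg_apply (f : PVA d) (S : Finset (Fin d)) :
    dvg f S = ∑ i, MvPolynomial.pderiv i (Dxi i f S) := by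
  simp [dvg, Dx]

lemma dvg_zero : dvg (0 : PVA d) = 0 := (dvgL d).map_zero

lemma dvg_apply_univ (f : PVA d) : dvg f Finset.univ = 0 := by
  simp [dvg_apply, Dxi_apply]

lemma dvg_dvg (f : PVA d) : dvg (dvg f) = 0 := by
  have expand : dvg (dvg f) = ∑ i, ∑ j, Dx i (Dx j (Dxi i (Dxi j f))) := by
    simp only [dvg, Dxi_sum, Dx_sum, Dxi_Dx]
  have anti : dvg (dvg f) = -dvg (dvg f) := by
    conv_lhs => rw [expand, Finset.sum_comm]
    rw [expand, ← Finset.sum_neg_distrib]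
    refine Finset.sum_congr rfl fun i _ => ?_
    rw [← Finset.sum_neg_distrib]
    refine Finset.sum_congr rfl fun j _ => ?_
    rw [Dx_Dx, Dxi_Dxi, Dx_neg, Dx_neg]
  exact self_eq_neg.mp anti

lemma IsHomog.dvg {j : ℕ} {f : PVA d} (hf : IsHomog (j + 1) f) : IsHomog j (dvg f) := by
  intro S hS
  rw [dvg_apply]
  refine Finset.sum_eq_zero fun i _ => ?_
  by_cases h : i ∈ S
  · simp [Dxi_apply, h]
  · have : f (insert i S) = 0 := hf _ (by rw [Finset.card_insert_of_notMem h]; omega)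
    simp [Dxi_apply, this]

lemma IsHomog.homotopy {j : ℕ} {f : PVA d} (hf : IsHomog j f) :
    IsHomog (j + 1) (homotopy f) := by
  intro S hS
  simp only [BCOV.homotopy, Finset.sum_apply, mulX, mulXi]
  refine Finset.sum_eq_zero fun i _ => ?_
  by_cases h : i ∈ S
  · have : f (S.erase i) = 0 := hf _ (by
      have := Finset.card_erase_add_one h
      omega)
    simp [this]
  · simp [h]

lemma dvg_eq_zero_of_isHomog_zero {f : PVA d} (hf : IsHomog 0 f) : dvg f = 0 := by
  funext S
  rw [dvg_apply]
  refine Finset.sum_eq_zero fun i _ => ?_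
  have : f (insert i S) = 0 := hf _ (by simp)
  simp [Dxi_apply, this]

/-- The Euler operator `Σ_i x_i ∂_{x_i}` on polynomials. -/
def euler (p : MPoly d) : MPoly d := ∑ i, MvPolynomial.X i * MvPolynomial.pderiv i p

lemma euler_add (p q : MPoly d) : euler (p + q) = euler p + euler q := by
  simp [euler, mul_add, Finset.sum_add_distrib]

lemma euler_monomial (s : Fin d →₀ ℕ) (a : ℂ) :
    euler (MvPolynomial.monomial s a) = (s.degree : ℂ) • MvPolynomial.monomial s a := by
  rw [euler, (MvPolynomial.isHomogeneous_monomial a rfl).sum_X_mul_pderiv, Nat.cast_smul_eq_nsmul]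

lemma coeff_euler (s : Fin d →₀ ℕ) (p : MPoly d) :
    MvPolynomial.coeff s (euler p) = s.degree * MvPolynomial.coeff s p := by
  induction p using MvPolynomial.induction_on' with
  | monomial t a =>
    rw [euler_monomial, MvPolynomial.coeff_smul, MvPolynomial.coeff_monomial, smul_eq_mul]
    split_ifs with h
    · rw [h]
    · simp
  | add p q hp hq => rw [euler_add, MvPolynomial.coeff_add, hp, hq, MvPolynomial.coeff_add, mul_add]

lemma exists_euler_add_smul_eq {m : ℕ} (hm : 0 < m) (p : MPoly d) :
    ∃ q, euler q + (m : ℂ) • q = p := by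
  induction p using MvPolynomial.induction_on' with
  | monomial t a =>
    refine ⟨MvPolynomial.monomial t (a / (t.degree + m)), ?_⟩
    have h : (t.degree : ℂ) + m ≠ 0 := by exact_mod_cast (by omega : t.degree + m ≠ 0)
    rw [euler_monomial, ← add_smul, MvPolynomial.smul_monomial, smul_eq_mul, mul_div_cancel₀ _ h]
  | add p q hp hq =>
    obtain ⟨p', rfl⟩ := hp
    obtain ⟨q', rfl⟩ := hq
    exact ⟨p' + q', by rw [euler_add, smul_add]; abel⟩

lemma eq_zero_of_euler_add_smul_eq_zero {m : ℕ} (hm : 0 < m) {p : MPoly d}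
    (hp : euler p + (m : ℂ) • p = 0) : p = 0 := by
  ext s
  have h : (s.degree : ℂ) + m ≠ 0 := by exact_mod_cast (by omega : s.degree + m ≠ 0)
  have := congrArg (MvPolynomial.coeff s) hp
  rw [MvPolynomial.coeff_add, coeff_euler, MvPolynomial.coeff_smul, smul_eq_mul, ← add_mul,
    MvPolynomial.coeff_zero] at this
  rw [MvPolynomial.coeff_zero]
  exact (mul_eq_zero.mp this).resolve_left h

lemma eq_C_of_pderiv_eq_zero {p : MPoly d} (hp : ∀ i, MvPolynomial.pderiv i p = 0) :
    p = MvPolynomial.C (MvPolynomial.constantCoeff p) := by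
  ext s
  have he : euler p = 0 := by simp [euler, hp]
  have := coeff_euler s p
  rw [he, MvPolynomial.coeff_zero] at this
  rw [MvPolynomial.coeff_C]
  split_ifs with h
  · rw [← h]; rfl
  · refine (mul_eq_zero.mp this.symm).resolve_left ?_
    rw [Nat.cast_eq_zero, Finsupp.degree_eq_zero_iff]
    exact fun h' => h h'.symm

/-- The anticommutator of the divergence and `Σ_i x_i ξ_i` is the degree operator. -/
lemma dvg_homotopy_add (f : PVA d) (S : Finset (Fin d)) :
    (dvg (homotopy f) + homotopy (dvg f)) S = euler (f S) + ((d - S.card : ℕ) : ℂ) • f S := by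
  have hterm : ∀ i j : Fin d,
      Dx i (Dxi i (mulX j (mulXi j f))) S + mulX j (mulXi j (Dx i (Dxi i f))) S =
        if i = j then MvPolynomial.X i * MvPolynomial.pderiv i (f S) +
          (if i ∈ S then 0 else f S) else 0 := by
    intro i j
    have h1 : Dxi i (mulX j (mulXi j f)) = mulX j (Dxi i (mulXi j f)) := by
      funext S
      by_cases h : i ∈ S <;> simp [Dxi_apply, mulX, h]
    have h2 : mulXi j (Dx i (Dxi i f)) = Dx i (mulXi j (Dxi i f)) := by
      funext S
      by_cases h : j ∈ S <;> simp [mulXi, Dx, h]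
    rw [h1, h2]
    by_cases hij : i = j
    · subst hij
      simp only [Dx, mulX, Dxi_mulXi_self, mulXi_Dxi_self, if_true]
      by_cases h : i ∈ S
      · simp [h]
      · simp [h, Derivation.leibniz, add_comm]
    · rw [Dxi_mulXi_of_ne hij]
      simp [Dx, mulX, hij, Derivation.leibniz, MvPolynomial.pderiv_X_of_ne (Ne.symm hij)]
  have hX : ∀ i, mulX i (mulXi i (dvg f)) = ∑ j, mulX i (mulXi i (Dx j (Dxi j f))) := by
    intro i
    funext S
    by_cases h : i ∈ S <;> simp [mulX, mulXi, h, dvg, Finset.mul_sum, Finset.smul_sum]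
  have h1 : dvg (homotopy f) = ∑ i, ∑ j, Dx i (Dxi i (mulX j (mulXi j f))) := by
    simp only [dvg, homotopy, Dxi_sum, Dx_sum]
  have h2 : homotopy (dvg f) = ∑ i, ∑ j, mulX j (mulXi j (Dx i (Dxi i f))) := by
    rw [homotopy, Finset.sum_comm]
    exact Finset.sum_congr rfl fun i _ => hX i
  rw [h1, h2, ← Finset.sum_add_distrib]
  simp only [← Finset.sum_add_distrib, Finset.sum_apply, Pi.add_apply, hterm, Finset.sum_ite_eq,
    Finset.mem_univ, if_true]
  rw [Finset.sum_add_distrib, euler]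
  congr 1
  rw [Finset.sum_ite, Finset.sum_const_zero, zero_add, Finset.sum_const, Nat.cast_smul_eq_nsmul]
  congr 1
  rw [show (Finset.univ.filter fun i => i ∉ S) = Sᶜ by ext; simp, Finset.card_compl,
    Fintype.card_fin]

/-- Poincaré lemma: divergence-free `j`-polyvector fields with `j < d` are divergences. -/
lemma exists_dvg_eq {j : ℕ} (hj : j < d) {f : PVA d} (hf : IsHomog j f) (h0 : dvg f = 0) :
    ∃ g : PVA d, IsHomog (j + 1) g ∧ dvg g = f := by
  have hm : 0 < d - j := by omega
  choose q hq using fun S => exists_euler_add_smul_eq hm (f S)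
  let g : PVA d := fun S => if S.card = j then q S else 0
  have hg : IsHomog j g := fun S hS => if_neg hS
  have hfg : dvg (homotopy g) + homotopy (dvg g) = f := by
    funext S
    rw [dvg_homotopy_add]
    by_cases h : S.card = j
    · simp only [g, h, if_true, hq]
    · simp [g, h, hf S h, euler]
  have hdg : dvg g = 0 := by
    have hN : dvg (homotopy (dvg g)) + homotopy (dvg (dvg g)) = 0 := by
      have : dvg (dvg (homotopy g) + homotopy (dvg g)) = 0 := by rw [hfg, h0]
      rw [dvg_add, dvg_dvg, zero_add] at this
      rw [this, dvg_dvg]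
      simp [homotopy, mulX, mulXi, funext_iff]
    funext S
    by_cases hS : S = Finset.univ
    · rw [hS, dvg_apply_univ]; rfl
    · have := congrFun hN S
      rw [dvg_homotopy_add] at this
      refine eq_zero_of_euler_add_smul_eq_zero ?_ this
      have := (Finset.card_lt_iff_ne_univ S).mpr hS
      rw [Fintype.card_fin] at this
      omega
  refine ⟨homotopy g, hg.homotopy, ?_⟩
  rw [hdg] at hfg
  simpa [homotopy, mulX, mulXi, funext_iff] using hfg

lemma exists_primitive_operator (d : ℕ) : ∃ P : ℕ → PVA d → PVA d,
    (∀ j f, IsHomog (j + 1) (P j f)) ∧ (∀ j, P j 0 = 0) ∧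
      ∀ j f, j < d → IsHomog j f → dvg f = 0 → dvg (P j f) = f := by
  have h : ∀ (j : ℕ) (f : PVA d), ∃ g : PVA d, IsHomog (j + 1) g ∧ (f = 0 → g = 0) ∧
      (j < d → IsHomog j f → dvg f = 0 → dvg g = f) := by
    intro j f
    by_cases hf : f = 0
    · exact ⟨0, isHomog_zero, fun _ => rfl, fun _ _ _ => by rw [hf, dvg_zero]⟩
    by_cases hP : j < d ∧ IsHomog j f ∧ dvg f = 0
    · obtain ⟨g, hg, hgf⟩ := exists_dvg_eq hP.1 hP.2.1 hP.2.2
      exact ⟨g, hg, fun h => absurd h hf, fun _ _ _ => hgf⟩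
    · exact ⟨0, isHomog_zero, fun _ => rfl, fun h1 h2 h3 => absurd ⟨h1, h2, h3⟩ hP⟩
  choose P h1 h2 h3 using h
  exact ⟨P, h1, fun j => h2 j 0 rfl, h3⟩

lemma isHomog_xiTop : IsHomog d (xiTop : PVA d) := fun S hS =>
  if_neg fun h => hS (by rw [h, Finset.card_univ, Fintype.card_fin])

lemma dvg_xiTop : dvg (xiTop : PVA d) = 0 := by
  funext S
  rw [dvg_apply]
  refine Finset.sum_eq_zero fun i _ => ?_
  by_cases h : i ∈ S
  · simp [Dxi_apply, h]
  · by_cases h' : insert i S = Finset.univ <;> simp [Dxi_apply, xiTop, h, h']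

lemma eq_smul_xiTop {f : PVA d} (hf : IsHomog d f) (h0 : dvg f = 0) : f = tauA f • xiTop := by
  funext S
  by_cases hS : S = Finset.univ
  · subst hS
    have hp : ∀ i, MvPolynomial.pderiv i (f Finset.univ) = 0 := by
      intro i
      have h := congrFun h0 (Finset.univ.erase i)
      rw [dvg_apply, Finset.sum_eq_single i] at h
      · simp only [Dxi_apply, Finset.notMem_erase, if_false,
          Finset.insert_erase (Finset.mem_univ i), Derivation.map_smul,
          Pi.zero_apply] at h
        refine (smul_eq_zero.mp h).resolve_left ?_
        simp [moveSign]
      · intro l _ hl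
        simp [Dxi_apply, hl]
      · simp
    conv_lhs => rw [eq_C_of_pderiv_eq_zero hp]
    simp [tauA, xiTop, MvPolynomial.smul_eq_C_mul]
  · have : S.card ≠ d := by
      have := (Finset.card_lt_iff_ne_univ S).mpr hS
      rw [Fintype.card_fin] at this
      omega
    simp [xiTop, hS, hf S this]

end Operators

section Complex

variable {d k : ℕ}

lemma T11_mem {c : F11 d} (hkd : k + 2 ≤ d) (hc : c ∈ C11 d k) : T11 d c ∈ C11 d k := by
  obtain ⟨h1, h2⟩ := hc
  refine ⟨fun i => ⟨(h1 (i + 1)).1.dvg, fun hi => ?_⟩, fun p => ⟨?_, fun hp => ?_⟩⟩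
  · change dvg (c.1 (i + 1)) = 0
    rw [(h1 (i + 1)).2 (by omega), dvg_zero]
  · change IsHomog p.1 (if p.2 = 0 then 0 else dvg (c.2 (p.1 + 1, p.2 - 1)))
    split_ifs
    · exact isHomog_zero
    · exact (h2 (p.1 + 1, p.2 - 1)).1.dvg
  · change (if p.2 = 0 then 0 else dvg (c.2 (p.1 + 1, p.2 - 1))) = 0
    split_ifs
    · rfl
    · rw [(h2 _).2 (by dsimp only; omega), dvg_zero]

lemma T11_comp_T11 : (T11 d).comp (T11 d) = 0 := by
  refine LinearMap.ext fun c => Prod.ext ?_ ?_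
  · funext i
    exact dvg_dvg _
  · funext p
    change (if p.2 = 0 then 0 else
      dvg (if p.2 - 1 = 0 then 0 else dvg (c.2 (p.1 + 1 + 1, p.2 - 1 - 1)))) = 0
    split_ifs
    · rfl
    · exact dvg_zero
    · exact dvg_dvg _

lemma mem_ker_T11 {c : F11 d} : c ∈ LinearMap.ker (T11 d) ↔
    (∀ i, dvg (c.1 (i + 1)) = 0) ∧ ∀ j i, dvg (c.2 (j + 1, i)) = 0 := by
  rw [LinearMap.mem_ker]
  constructor
  · intro h
    refine ⟨fun i => congrFun (congrArg Prod.fst h) i, fun j i => ?_⟩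
    exact congrFun (congrArg Prod.snd h) (j, i + 1)
  · rintro ⟨h1, h2⟩
    refine Prod.ext (funext h1) (funext fun p => ?_)
    change (if p.2 = 0 then 0 else dvg (c.2 (p.1 + 1, p.2 - 1))) = 0
    rw [h2, ite_self]

lemma exists_T11_eq_e2_iff (hkd : k + 2 ≤ d) (μ : PVA d) :
    (∃ c ∈ C11 d k, T11 d c = e2 d μ) ↔ ∃ ν : PVA d, IsHomog (k + 2) ν ∧ dvg ν = μ := by
  constructor
  · rintro ⟨c, hc, h⟩
    exact ⟨c.1 1, (hc.1 1).1, congrFun (congrArg Prod.fst h) 0⟩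
  · rintro ⟨ν, hν, rfl⟩
    refine ⟨(fun i => if i = 1 then ν else 0, 0), ⟨fun i => ⟨?_, fun hi => ?_⟩,
      fun p => ⟨isHomog_zero, fun _ => rfl⟩⟩, Prod.ext ?_ ?_⟩
    · dsimp only
      split_ifs with h
      · subst h; exact hν
      · exact isHomog_zero
    · exact if_neg (by omega)
    · funext i
      change dvg (if i + 1 = 1 then ν else 0) = if i = 0 then dvg ν else 0
      by_cases h : i = 0 <;> simp [h, dvg_zero]
    · funext p
      change (if p.2 = 0 then 0 else dvg 0) = 0
      rw [dvg_zero, ite_self]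

lemma e1_mem (hkd : k + 2 ≤ d) (z : ℂ) : e1 d k z ∈ C11 d k ⊓ LinearMap.ker (T11 d) := by
  refine ⟨⟨fun i => ⟨?_, fun hi => if_neg (by omega)⟩, fun p => ⟨isHomog_zero, fun _ => rfl⟩⟩,
    mem_ker_T11.mpr ⟨fun i => ?_, fun j i => dvg_zero⟩⟩
  · dsimp only [e1]
    split_ifs with h
    · rw [show k + 1 + i = d by omega]
      exact isHomog_xiTop.smul z
    · exact isHomog_zero
  · dsimp only [e1]
    split_ifs
    · rw [dvg_smul, dvg_xiTop, smul_zero]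
    · exact dvg_zero

lemma e2_mem {μ : PVA d} (hμ : IsHomog (k + 1) μ) :
    e2 d μ ∈ C11 d k ⊓ LinearMap.ker (T11 d) := by
  refine ⟨⟨fun i => ⟨?_, fun hi => if_neg (by omega)⟩, fun p => ⟨isHomog_zero, fun _ => rfl⟩⟩,
    mem_ker_T11.mpr ⟨fun i => dvg_zero, fun j i => dvg_zero⟩⟩
  dsimp only [e2]
  split_ifs with h
  · subst h; exact hμ
  · exact isHomog_zero

lemma e3_snd_zero (n : ∀ j : {j : Fin d // (j : ℕ) ≠ k}, ↥(PVd d ((j : Fin d) : ℕ)))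
    {j : ℕ} (hj : j < d) (hjk : j ≠ k) : (e3 d k n).2 (j, 0) = n ⟨⟨j, hj⟩, hjk⟩ :=
  dif_pos (⟨rfl, hj, hjk⟩ : 0 = 0 ∧ j < d ∧ j ≠ k)

lemma e3_snd_of_not (n : ∀ j : {j : Fin d // (j : ℕ) ≠ k}, ↥(PVd d ((j : Fin d) : ℕ)))
    {j i : ℕ} (h : ¬(i = 0 ∧ j < d ∧ j ≠ k)) : (e3 d k n).2 (j, i) = 0 :=
  dif_neg h

lemma e3_mem (n : ∀ j : {j : Fin d // (j : ℕ) ≠ k}, ↥(PVd d ((j : Fin d) : ℕ))) :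
    e3 d k n ∈ C11 d k ⊓ LinearMap.ker (T11 d) := by
  refine ⟨⟨fun i => ⟨isHomog_zero, fun _ => rfl⟩, fun p => ⟨?_, fun hp => dif_neg (by omega)⟩⟩,
    mem_ker_T11.mpr ⟨fun i => dvg_zero, fun j i => ?_⟩⟩
  · dsimp only [e3]
    split_ifs with h
    · exact (n ⟨⟨p.1, h.2.1⟩, h.2.2⟩).2.1
    · exact isHomog_zero
  · dsimp only [e3]
    split_ifs with h
    · exact (n ⟨⟨j + 1, h.2.1⟩, h.2.2⟩).2.2
    · exact dvg_zero

/-- `e1` as a linear map to the cocycles. -/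
def e1L (hkd : k + 2 ≤ d) : ℂ →ₗ[ℂ] ↥(C11 d k ⊓ LinearMap.ker (T11 d)) where
  toFun z := ⟨e1 d k z, e1_mem hkd z⟩
  map_add' z w := by
    refine Subtype.ext (Prod.ext (funext fun i => ?_) (add_zero _).symm)
    by_cases h : i = d - k - 1 <;> simp [e1, h, add_smul]
  map_smul' a z := by
    refine Subtype.ext (Prod.ext (funext fun i => ?_) (smul_zero _).symm)
    by_cases h : i = d - k - 1 <;> simp [e1, h, mul_smul]

/-- `e2` as a linear map to the cocycles. -/
def e2L (d k : ℕ) : ↥(PVsub d (k + 1)) →ₗ[ℂ] ↥(C11 d k ⊓ LinearMap.ker (T11 d)) where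
  toFun μ := ⟨e2 d μ, e2_mem μ.2⟩
  map_add' μ ν := by
    refine Subtype.ext (Prod.ext (funext fun i => ?_) (add_zero _).symm)
    by_cases h : i = 0 <;> simp [e2, h]
  map_smul' a μ := by
    refine Subtype.ext (Prod.ext (funext fun i => ?_) (smul_zero _).symm)
    by_cases h : i = 0 <;> simp [e2, h]

/-- `e3` as a linear map to the cocycles. -/
def e3L (d k : ℕ) : (∀ j : {j : Fin d // (j : ℕ) ≠ k}, ↥(PVd d ((j : Fin d) : ℕ))) →ₗ[ℂ]
    ↥(C11 d k ⊓ LinearMap.ker (T11 d)) where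
  toFun n := ⟨e3 d k n, e3_mem n⟩
  map_add' m n := by
    refine Subtype.ext (Prod.ext (add_zero _).symm (funext fun p => ?_))
    by_cases h : p.2 = 0 ∧ p.1 < d ∧ p.1 ≠ k <;> simp [e3, h]
  map_smul' a n := by
    refine Subtype.ext (Prod.ext (smul_zero _).symm (funext fun p => ?_))
    by_cases h : p.2 = 0 ∧ p.1 < d ∧ p.1 ≠ k <;> simp [e3, h]

/-- The coboundaries inside the cocycles. -/
abbrev coboundaries (d k : ℕ) : Submodule ℂ ↥(C11 d k ⊓ LinearMap.ker (T11 d)) :=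
  Submodule.comap (C11 d k ⊓ LinearMap.ker (T11 d)).subtype (Submodule.map (T11 d) (C11 d k))

lemma e2L_mem_coboundaries_iff (hkd : k + 2 ≤ d) (μ : ↥(PVsub d (k + 1))) :
    e2L d k μ ∈ coboundaries d k ↔ μ ∈ Dq d k :=
  exists_T11_eq_e2_iff hkd (μ : PVA d)

/-- The comparison map from `W11 d k` to the cohomology. -/
def realization (hkd : k + 2 ≤ d) : W11 d k →ₗ[ℂ] Coh11 d k :=
  LinearMap.coprod ((coboundaries d k).mkQ.comp (e1L hkd))
    (LinearMap.coprod
      ((Dq d k).liftQ ((coboundaries d k).mkQ.comp (e2L d k)) fun μ hμ => by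
        rw [LinearMap.mem_ker, LinearMap.comp_apply, Submodule.mkQ_apply,
          Submodule.Quotient.mk_eq_zero]
        exact (e2L_mem_coboundaries_iff hkd μ).mpr hμ)
      ((coboundaries d k).mkQ.comp (e3L d k)))

lemma realization_apply (hkd : k + 2 ≤ d) (z : ℂ) (μ : ↥(PVsub d (k + 1)))
    (n : ∀ j : {j : Fin d // (j : ℕ) ≠ k}, ↥(PVd d ((j : Fin d) : ℕ))) :
    realization hkd (z, Submodule.Quotient.mk μ, n) =
      Submodule.Quotient.mk (e1L hkd z + (e2L d k μ + e3L d k n)) := rfl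

lemma realization_injective (hkd : k + 2 ≤ d) :
    Function.Injective (realization hkd) := by
  rw [injective_iff_map_eq_zero]
  rintro ⟨z, q, n⟩ h
  obtain ⟨μ, rfl⟩ := Submodule.Quotient.mk_surjective _ q
  rw [realization_apply, Submodule.Quotient.mk_eq_zero] at h
  obtain ⟨c, hc, h⟩ := h
  have h1 : ∀ i, dvg (c.1 (i + 1)) = (if i = d - k - 1 then z • xiTop else 0) +
      ((if i = 0 then (μ : PVA d) else 0) + 0) := fun i => congrFun (congrArg Prod.fst h) i
  have h2 : ∀ p : ℕ × ℕ, (if p.2 = 0 then 0 else dvg (c.2 (p.1 + 1, p.2 - 1))) =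
      0 + (0 + (e3 d k n).2 p) := fun p => congrFun (congrArg Prod.snd h) p
  have hz : z = 0 := by
    have := h1 (d - k - 1)
    rw [(hc.1 _).2 (by omega), dvg_zero, if_pos rfl, if_neg (by omega), add_zero, add_zero] at this
    have := congrFun this Finset.univ
    simpa [xiTop] using this.symm
  have hμ : μ ∈ Dq d k := by
    have := h1 0
    rw [if_neg (by omega), if_pos rfl, add_zero, zero_add, zero_add] at this
    exact ⟨c.1 1, (hc.1 1).1, this⟩
  have hn : n = 0 := by
    funext j
    have := h2 (((j : Fin d) : ℕ), 0)
    rw [if_pos rfl, zero_add, zero_add] at this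
    rw [e3_snd_zero n j.1.2 j.2] at this
    exact Subtype.ext this.symm
  rw [hz, hn, (Submodule.Quotient.mk_eq_zero _).mpr hμ]
  rfl

lemma realization_surjective (hkd : k + 2 ≤ d) :
    Function.Surjective (realization hkd) := by
  intro y
  obtain ⟨⟨c, hc, hker⟩, rfl⟩ := Submodule.Quotient.mk_surjective _ y
  obtain ⟨hker1, hker2⟩ := mem_ker_T11.mp hker
  have hlast := (hc.1 (d - k - 1)).1
  rw [show k + 1 + (d - k - 1) = d by omega] at hlast
  have hlast0 : dvg (c.1 (d - k - 1)) = 0 := by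
    have := hker1 (d - k - 1 - 1)
    rwa [show d - k - 1 - 1 + 1 = d - k - 1 by omega] at this
  have hdvg2 : ∀ p : ℕ × ℕ, dvg (c.2 p) = 0 := by
    rintro ⟨_ | j, i⟩
    · exact dvg_eq_zero_of_isHomog_zero (hc.2 (0, i)).1
    · exact hker2 j i
  obtain ⟨P, hP, hP0, hPdvg⟩ := exists_primitive_operator d
  let n : ∀ j : {j : Fin d // (j : ℕ) ≠ k}, ↥(PVd d ((j : Fin d) : ℕ)) :=
    fun j => ⟨c.2 (((j : Fin d) : ℕ), 0), (hc.2 (((j : Fin d) : ℕ), 0)).1, hdvg2 _⟩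
  let b : F11 d :=
    (fun i => if i ≤ 1 ∨ d - k - 1 < i then 0 else P (k + i) (c.1 (i - 1)),
      fun p => if p.1 = 0 then 0 else P (p.1 - 1) (c.2 (p.1 - 1, p.2 + 1)))
  have hb : b ∈ C11 d k := by
    refine ⟨fun i => ⟨?_, fun hi => if_pos (Or.inr hi)⟩, fun p => ⟨?_, fun hp => ?_⟩⟩
    · dsimp only [b]
      split_ifs with h
      · exact isHomog_zero
      · rw [show k + 1 + i = k + i + 1 by omega]
        exact hP _ _
    · dsimp only [b]
      split_ifs with h
      · rw [h]; exact isHomog_zero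
      · have := hP (p.1 - 1) (c.2 (p.1 - 1, p.2 + 1))
        rwa [show p.1 - 1 + 1 = p.1 by omega] at this
    · dsimp only [b]
      split_ifs with h
      · rfl
      · rw [(hc.2 (p.1 - 1, p.2 + 1)).2 (by dsimp only; omega), hP0]
  refine ⟨(tauA (c.1 (d - k - 1)), Submodule.Quotient.mk ⟨c.1 0, (hc.1 0).1⟩, n), ?_⟩
  rw [realization_apply, eq_comm, Submodule.Quotient.eq]
  refine ⟨b, hb, Prod.ext (funext fun i => ?_) (funext fun p => ?_)⟩
  · change dvg (if i + 1 ≤ 1 ∨ d - k - 1 < i + 1 then 0 else P (k + (i + 1)) (c.1 i)) =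
      c.1 i - ((if i = d - k - 1 then tauA (c.1 (d - k - 1)) • xiTop else 0) +
        ((if i = 0 then c.1 0 else 0) + 0))
    by_cases hi0 : i = 0
    · subst hi0
      rw [if_pos (by omega), if_neg (by omega), if_pos rfl, dvg_zero]
      abel
    by_cases hi1 : i = d - k - 1
    · subst hi1
      rw [if_pos (by omega), if_pos rfl, if_neg hi0, dvg_zero, ← eq_smul_xiTop hlast hlast0]
      abel
    rw [if_neg hi1, if_neg hi0, add_zero, add_zero, sub_zero]
    by_cases hi2 : d - k - 1 < i
    · rw [if_pos (by omega), (hc.1 i).2 hi2, dvg_zero]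
    · rw [if_neg (by omega)]
      refine hPdvg _ _ (by omega) ?_ ?_
      · rw [show k + (i + 1) = k + 1 + i by omega]
        exact (hc.1 i).1
      · have := hker1 (i - 1)
        rwa [show i - 1 + 1 = i by omega] at this
  · obtain ⟨j, i⟩ := p
    change (if i = 0 then 0 else dvg (if j + 1 = 0 then 0 else
      P j (c.2 (j, i - 1 + 1)))) = c.2 (j, i) - (0 + (0 + (e3 d k n).2 (j, i)))
    rw [zero_add, zero_add]
    by_cases hi : i = 0
    · subst hi
      rw [if_pos rfl, eq_comm, sub_eq_zero]
      by_cases hj : j < d ∧ j ≠ k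
      · rw [e3_snd_zero n hj.1 hj.2]
      · rw [(hc.2 (j, 0)).2 (by dsimp only; omega)]
        exact (e3_snd_of_not n fun h => hj h.2).symm
    · have he : (e3 d k n).2 (j, i) = 0 := e3_snd_of_not n fun h => hi h.1
      rw [if_neg hi, if_neg (Nat.succ_ne_zero j), he, sub_zero,
        show i - 1 + 1 = i by omega]
      by_cases hj : j < d
      · exact hPdvg _ _ hj (hc.2 (j, i)).1 (hdvg2 _)
      · rw [(hc.2 (j, i)).2 (by dsimp only; omega), hP0, dvg_zero]

end Complex

/-- Fix `d ≥ 4` and `2 ≤ k ≤ d−2`.  With `C = C_1 ⊕ C_2` and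
`T` as above: `T` is a square-zero differential on `C`, and `ker T / im T` is
`ℂ`-linearly isomorphic to
`ℂ ⊕ PV^{k+1}/∂(PV^{k+2}) ⊕ ⨁_{j ≤ d−1, j ≠ k} PV^j_∂`, where the `ℂ`-summand
is realized by the classes of constant multiples of `ξ_1⋯ξ_d` in the summand
`PV^d⟨−(d−k−1)⟩` of `C_1`, the middle summand is realized in the summand
`PV^{k+1}⟨0⟩` of `C_1` (whose intersection with `im T` is exactly
`∂(PV^{k+2})`), and the last summand is realized by the `⟨0⟩`-inclusions of
divergence-free elements into `C_2`.  (This computes the cohomology of the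
fields of minimal BCOV theory with `k`-potentials on `ℂ^d` with respect to
`t∂`.) -/
theorem kpotential_bcov_cohomology (d k : ℕ) (hd : 4 ≤ d)
    (hk2 : 2 ≤ k) (hkd : k ≤ d - 2) :
    (∀ c ∈ C11 d k, T11 d c ∈ C11 d k) ∧
    (T11 d).comp (T11 d) = 0 ∧
    (∀ μ : PVA d, IsHomog (k + 1) μ →
      ((∃ c ∈ C11 d k, T11 d c = e2 d μ) ↔
        ∃ ν : PVA d, IsHomog (k + 2) ν ∧ dvg ν = μ)) ∧
    ∃ φ : W11 d k →ₗ[ℂ] Coh11 d k, Function.Bijective φ ∧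
      (∀ z : ℂ, ∃ h : e1 d k z ∈ C11 d k ⊓ LinearMap.ker (T11 d),
        φ (z, 0, 0) = Submodule.Quotient.mk ⟨e1 d k z, h⟩) ∧
      (∀ μ : ↥(PVsub d (k + 1)),
        ∃ h : e2 d (μ : PVA d) ∈ C11 d k ⊓ LinearMap.ker (T11 d),
          φ (0, Submodule.Quotient.mk μ, 0) =
            Submodule.Quotient.mk ⟨e2 d (μ : PVA d), h⟩) ∧
      (∀ n : ∀ j : {j : Fin d // (j : ℕ) ≠ k}, ↥(PVd d ((j : Fin d) : ℕ)),
        ∃ h : e3 d k n ∈ C11 d k ⊓ LinearMap.ker (T11 d),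
          φ (0, 0, n) = Submodule.Quotient.mk ⟨e3 d k n, h⟩) := by
  have hkd' : k + 2 ≤ d := by omega
  exact ⟨fun c hc => T11_mem hkd' hc, T11_comp_T11, fun μ _ => exists_T11_eq_e2_iff hkd' μ,
    realization hkd', ⟨realization_injective hkd', realization_surjective hkd'⟩,
    fun z => ⟨e1_mem hkd' z, by
      refine (realization_apply hkd' z 0 0).trans ?_
      rw [map_zero, map_zero, add_zero, add_zero]
      rfl⟩,
    fun μ => ⟨e2_mem μ.2, by
      refine (realization_apply hkd' 0 μ 0).trans ?_
      rw [map_zero, map_zero, add_zero, zero_add]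
      rfl⟩,
    fun n => ⟨e3_mem n, by
      refine (realization_apply hkd' 0 0 n).trans ?_
      rw [map_zero, map_zero, zero_add, zero_add]
      rfl⟩⟩

end BCOV
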